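/- Let m ≥ 1 and let X = ℝ^m with its usual topology, and endow the space C(X) of continuous self-maps of X with the compact-open topology. Then the set of non-iterates, i.e., the complement in C(X) of W(X) = {fⁿ : f ∈ C(X), n ≥ 2}, is dense in C(X). -/

import Mathlib

/-- Set-theoretic obstruction to being an iterate. -/
lemma no_root {X : Type*} (f g : X → X) (n : ℕ) (hn : 2 ≤ n) (hfg : f = g^[n]) (x0 : X)
    (hc : ∀ y, y ≠ x0 → (f ⁻¹' {y}).Countable)
    (hp : ∀ k, 1 ≤ k → f^[k] x0 ≠ x0)
    (hu : ¬ (f ⁻¹' {x0} ∩ Set.range f).Countable) : False := by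
  have comm : ∀ z, f (g z) = g (f z) := by
    intro z
    rw [hfg]
    exact (Function.iterate_succ_apply g n z).symm.trans (Function.iterate_succ_apply' g n z)
  have hg0 : ∀ k, 1 ≤ k → g^[k] x0 ≠ x0 := by
    intro k hk h
    apply hp k hk
    rw [hfg, ← Function.iterate_mul, mul_comm, Function.iterate_mul]
    exact Function.iterate_fixed h n
  have h1 : (g '' (f ⁻¹' {x0})).Countable := by
    refine (hc (g x0) (hg0 1 le_rfl)).mono ?_
    rintro _ ⟨a, ha, rfl⟩
    simp only [Set.mem_preimage, Set.mem_singleton_iff] at ha ⊢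
    rw [comm, ha]
  have h2 : x0 ∉ g '' (f ⁻¹' {x0}) := by
    rintro ⟨a, ha, hga⟩
    simp only [Set.mem_preimage, Set.mem_singleton_iff] at ha
    apply hg0 (n - 1) (by omega)
    rw [← hga, ← Function.iterate_succ_apply, show (n - 1).succ = n by omega, ← hfg, ha, hga]
  have h3 : (f ⁻¹' (g '' (f ⁻¹' {x0}))).Countable := by
    rw [← Set.biUnion_preimage_singleton]
    refine h1.biUnion fun y hy => hc y ?_
    rintro rfl
    exact h2 hy
  apply hu
  refine (h3.image (g^[n-1])).mono ?_
  rintro _ ⟨hz, b, rfl⟩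
  refine ⟨g b, ⟨f b, hz, (comm b).symm⟩, ?_⟩
  rw [← Function.iterate_succ_apply, show (n - 1).succ = n by omega, ← hfg]

open MvPolynomial in
lemma finite_fiber {m : ℕ} (p : Fin m → MvPolynomial (Fin m) ℝ) (c : ℝ) (hc : c ≠ 0) (N : ℕ)
    (hN : ∀ i, (p i).totalDegree < N) (q : Fin m → ℝ) :
    {x : Fin m → ℝ | ∀ i, eval x (p i) + c * x i ^ N = q i}.Finite := by
  set S := {x : Fin m → ℝ | ∀ i, eval x (p i) + c * x i ^ N = q i} with hS
  let ev : MvPolynomial (Fin m) ℝ →ₐ[ℝ] (S → ℝ) := aeval (fun i s => s.1 i)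
  have hev : ∀ P s, ev P s = eval s.1 P := by
    intro P s
    have : ((Pi.evalAlgHom ℝ (fun _ : S => ℝ) s).comp ev) = aeval s.1 := by
      apply MvPolynomial.algHom_ext
      intro i
      simp [ev]
    have h := congrArg (fun φ => φ P) this
    simpa [MvPolynomial.aeval_eq_eval] using h
  let E : Set (Fin m →₀ ℕ) := {v | ∀ i, v i < N}
  have hE : E.Finite := by
    refine (Set.finite_Iic (Finsupp.equivFunOnFinite.symm (fun _ : Fin m => N))).subset ?_
    intro v hv i
    simpa using (hv i).le
  let V : Submodule ℝ (S → ℝ) := Submodule.span ℝ ((fun v => ev (monomial v 1)) '' E)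
  have key : ∀ d : ℕ, ∀ P : MvPolynomial (Fin m) ℝ, P.totalDegree < d → ev P ∈ V := by
    intro d
    induction d with
    | zero => intro P h; omega
    | succ d ih =>
      intro P hP
      rw [P.as_sum, map_sum]
      refine Submodule.sum_mem _ fun v hv => ?_
      have hvd := le_totalDegree hv
      have : monomial v (coeff v P) = (coeff v P) • (monomial v (1:ℝ)) := by
        rw [smul_monomial]; simp
      rw [this, map_smul]
      refine V.smul_mem _ ?_
      by_cases hvE : v ∈ E
      · exact Submodule.subset_span ⟨v, hvE, rfl⟩
      · simp only [E, Set.mem_ofPred_eq, not_forall, not_lt] at hvE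
        obtain ⟨i, hi⟩ := hvE
        set β := v - Finsupp.single i N with hβ
        have hvβ : v = β + Finsupp.single i N := by
          rw [hβ, tsub_add_cancel_of_le]
          rw [Finsupp.single_le_iff]; exact hi
        have h1 : ev (monomial v 1) = ev (monomial β 1 * (C (q i / c) - C (1/c) * p i)) := by
          funext s
          rw [hev, hev, hvβ, ← one_mul (1:ℝ), ← monomial_mul, map_mul, map_mul, one_mul]
          congr 1
          have := s.2 i
          simp only [eval_monomial, Finsupp.prod_single_index, pow_zero, one_mul, map_sub, map_mul, eval_C]
          field_simp
          linarith
        rw [h1]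
        apply ih
        have e1 := totalDegree_mul (monomial β (1:ℝ)) (C (q i / c) - C (1/c) * p i)
        have e2 := totalDegree_sub (C (q i / c)) (C (1/c) * p i)
        have e3 := totalDegree_mul (C (1/c)) (p i)
        rw [totalDegree_C] at e2 e3
        have e4 : (monomial β (1:ℝ)).totalDegree = β.sum fun _ e => e :=
          totalDegree_monomial _ one_ne_zero
        have e5 : (v.sum fun _ e => e) = (β.sum fun _ e => e) + N := by
          rw [hvβ, Finsupp.sum_add_index' (by simp) (by simp), Finsupp.sum_single_index rfl]
        have := hN i
        have e6 : max 0 (C (1/c) * p i).totalDegree = (C (1/c) * p i).totalDegree := by simp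
        omega
  have hfin : Module.Finite ℝ ev.range := by
    have hV : FiniteDimensional ℝ V := FiniteDimensional.span_of_finite ℝ (hE.image _)
    have hle : Subalgebra.toSubmodule ev.range ≤ V := by
      rintro _ ⟨P, rfl⟩
      exact key _ P (Nat.lt_succ_self _)
    exact Submodule.finiteDimensional_of_le hle
  have hcoord : ∀ i, ((fun x : Fin m → ℝ => x i) '' S).Finite := by
    intro i
    obtain ⟨r, hr, hr0⟩ := IsIntegral.of_finite ℝ (⟨ev (X i), X i, rfl⟩ : ev.range)
    refine (r.roots.toFinset.finite_toSet).subset ?_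
    rintro _ ⟨s, hs, rfl⟩
    simp only [Finset.mem_coe, Multiset.mem_toFinset, Polynomial.mem_roots hr.ne_zero, Polynomial.IsRoot]
    have h := congrArg (fun z : ev.range => z.1 ⟨s, hs⟩) hr0
    have h2 := Polynomial.hom_eval₂ r (algebraMap ℝ ev.range)
      (((Pi.evalAlgHom ℝ (fun _ : S => ℝ) ⟨s, hs⟩).comp ev.range.val : ev.range →ₐ[ℝ] ℝ) : ev.range →+* ℝ) (⟨ev (X i), X i, rfl⟩ : ev.range)
    rw [hr0, map_zero] at h2
    rw [AlgHom.comp_algebraMap] at h2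
    simp only [RingHom.coe_coe, AlgHom.comp_apply, Subalgebra.coe_val, Pi.evalAlgHom_apply, hev, eval_X] at h2
    exact h2.symm
  refine (Set.Finite.pi' hcoord).subset ?_
  intro x hx i
  exact ⟨x, hx, rfl⟩

open MvPolynomial in
lemma weier {m : ℕ} (R : ℝ) (F : (Fin m → ℝ) → ℝ) (hF : Continuous F) (ε : ℝ) (hε : 0 < ε) :
    ∃ p : MvPolynomial (Fin m) ℝ, ∀ x, ‖x‖ ≤ R → |eval x p - F x| < ε := by
  let K : Set (Fin m → ℝ) := Metric.closedBall 0 R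
  have hK : CompactSpace K := isCompact_iff_compactSpace.mp (isCompact_closedBall _ _)
  let ev : MvPolynomial (Fin m) ℝ →ₐ[ℝ] C(K, ℝ) :=
    aeval (fun i => ⟨fun s => s.1 i, (continuous_apply i).comp continuous_subtype_val⟩)
  have hev : ∀ P s, ev P s = eval s.1 P := by
    intro P s
    have : ((ContinuousMap.evalAlgHom ℝ ℝ s).comp ev) = aeval s.1 := by
      apply MvPolynomial.algHom_ext
      intro i
      simp [ev]
    have h := congrArg (fun φ => φ P) this
    simpa [MvPolynomial.aeval_eq_eval] using h
  have hsep : ev.range.SeparatesPoints := by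
    intro x y hxy
    obtain ⟨i, hi⟩ : ∃ i, x.1 i ≠ y.1 i := by
      by_contra! h
      exact hxy (Subtype.ext (funext h))
    refine ⟨ev (X i), ⟨ev (X i), ⟨X i, rfl⟩, rfl⟩, ?_⟩
    simpa [hev] using hi
  obtain ⟨⟨_, P, rfl⟩, h⟩ := ContinuousMap.exists_mem_subalgebra_near_continuous_of_separatesPoints
    ev.range hsep (fun x : K => F x.1) (by fun_prop) ε hε
  refine ⟨P, fun x hx => ?_⟩
  have := h ⟨x, by simpa [K] using hx⟩
  simpa [hev, Real.norm_eq_abs] using this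

open MvPolynomial in
lemma poly_bound {m : ℕ} (p : MvPolynomial (Fin m) ℝ) (d : ℕ) (hd : p.totalDegree ≤ d) :
    ∃ C : ℝ, 0 ≤ C ∧ ∀ x : Fin m → ℝ, 1 ≤ ‖x‖ → |eval x p| ≤ C * ‖x‖ ^ d := by
  refine ⟨∑ v ∈ p.support, |coeff v p|, Finset.sum_nonneg fun _ _ => abs_nonneg _, fun x hx => ?_⟩
  rw [eval_eq', Finset.sum_mul]
  refine (Finset.abs_sum_le_sum_abs _ _).trans (Finset.sum_le_sum fun v hv => ?_)
  rw [abs_mul]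
  refine mul_le_mul_of_nonneg_left ?_ (abs_nonneg _)
  rw [Finset.abs_prod]
  calc ∏ i, |x i ^ v i| ≤ ∏ i, ‖x‖ ^ v i := by
        refine Finset.prod_le_prod (fun _ _ => abs_nonneg _) fun i _ => ?_
        rw [abs_pow]
        exact pow_le_pow_left₀ (abs_nonneg _) (norm_le_pi_norm x i) _
    _ = ‖x‖ ^ (∑ i, v i) := Finset.prod_pow_eq_pow_sum _ _ _
    _ ≤ ‖x‖ ^ d := by
        refine pow_le_pow_right₀ hx (le_trans ?_ hd)
        have := le_totalDegree hv
        rwa [Finsupp.sum_fintype _ _ (by simp)] at this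

/-- The radial map collapsing the unit ball around `c` to `c`. -/
noncomputable def collapse {m : ℕ} (c x : Fin m → ℝ) : Fin m → ℝ :=
  c + (min 1 (max 0 (‖x - c‖ - 1))) • (x - c)

lemma collapse_cont {m : ℕ} (c : Fin m → ℝ) : Continuous (collapse c) := by
  unfold collapse
  fun_prop

lemma collapse_near {m : ℕ} (c x : Fin m → ℝ) (h : ‖x - c‖ ≤ 1) : collapse c x = c := by
  unfold collapse
  rw [max_eq_left (by linarith), min_eq_right zero_le_one, zero_smul, add_zero]

lemma collapse_far {m : ℕ} (c x : Fin m → ℝ) (h : 2 ≤ ‖x - c‖) : collapse c x = x := by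
  unfold collapse
  rw [max_eq_right (by linarith), min_eq_left (by linarith), one_smul, add_sub_cancel]

lemma collapse_norm {m : ℕ} (c x y : Fin m → ℝ) (h : collapse c x = collapse c y)
    (hc : collapse c x ≠ c) : ‖y - c‖ ≤ ‖x - c‖ := by
  by_contra! hlt
  have hx : 1 < ‖x - c‖ := by
    by_contra! h1
    exact hc (collapse_near c x h1)
  unfold collapse at h
  have h2 := congrArg norm (add_left_cancel h)
  rw [norm_smul, norm_smul] at h2
  have hs : 0 < min 1 (max 0 (‖x - c‖ - 1)) :=
    lt_min one_pos (lt_max_of_lt_right (by linarith))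
  have hs' : min 1 (max 0 (‖x - c‖ - 1)) ≤ min 1 (max 0 (‖y - c‖ - 1)) := by
    gcongr
  rw [Real.norm_of_nonneg hs.le, Real.norm_of_nonneg (hs.le.trans hs')] at h2
  have := mul_lt_mul_of_pos_left hlt hs
  have := mul_le_mul_of_nonneg_right hs' (norm_nonneg (y - c))
  linarith

lemma collapse_inj {m : ℕ} (c x y : Fin m → ℝ) (h : collapse c x = collapse c y)
    (hc : collapse c x ≠ c) : x = y := by
  have hn : ‖x - c‖ = ‖y - c‖ :=
    le_antisymm (collapse_norm c y x h.symm (h ▸ hc)) (collapse_norm c x y h hc)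
  have hx : 1 < ‖x - c‖ := by
    by_contra! h1
    exact hc (collapse_near c x h1)
  have hs : 0 < min 1 (max 0 (‖x - c‖ - 1)) :=
    lt_min one_pos (lt_max_of_lt_right (by linarith))
  unfold collapse at h
  have h2 := add_left_cancel h
  rw [← hn] at h2
  exact sub_left_injective (smul_right_injective _ hs.ne' h2)

lemma growth {m : ℕ} (p : Fin m → MvPolynomial (Fin m) ℝ) (c : ℝ) (hc : 0 < c) (N : ℕ)
    (hN : ∀ i, (p i).totalDegree ≤ N + 1) (hm : 1 ≤ m) :
    ∃ T : ℝ, 1 ≤ T ∧ ∀ x : Fin m → ℝ, T ≤ ‖x‖ →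
      ‖x‖ + 10 ≤ ‖(fun i => MvPolynomial.eval x (p i) + c * x i ^ (N + 2) : Fin m → ℝ)‖ := by
  choose C hC0 hC using fun i => poly_bound (p i) (N + 1) (hN i)
  have hS0 : 0 ≤ ∑ i, C i := Finset.sum_nonneg fun i _ => hC0 i
  refine ⟨1 + (∑ i, C i + 11) / c, by
    have : 0 ≤ (∑ i, C i + 11) / c := by positivity
    linarith, fun x hx => ?_⟩
  have hr1 : 1 ≤ ‖x‖ := by
    have : 0 ≤ (∑ i, C i + 11) / c := by positivity
    linarith
  have hr2 : ∑ i, C i + 11 ≤ c * ‖x‖ := by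
    have : (∑ i, C i + 11) / c ≤ ‖x‖ := by linarith
    rw [div_le_iff₀ hc] at this
    linarith
  have : Nonempty (Fin m) := ⟨⟨0, hm⟩⟩
  obtain ⟨i, hi⟩ : ∃ i, ‖x‖ = |x i| := by
    obtain ⟨i, hi⟩ := Finite.exists_max (fun i => |x i|)
    refine ⟨i, le_antisymm ?_ (norm_le_pi_norm x i)⟩
    exact (pi_norm_le_iff_of_nonneg (abs_nonneg _)).2 hi
  refine le_trans ?_ (norm_le_pi_norm _ i)
  have h1 := hC i x hr1
  have h2 : C i ≤ ∑ i, C i := Finset.single_le_sum (fun i _ => hC0 i) (Finset.mem_univ i)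
  have h3 : |c * x i ^ (N + 2)| = ‖x‖ ^ (N + 1) * (c * ‖x‖) := by
    rw [abs_mul, abs_pow, ← hi, abs_of_pos hc]; ring
  have h4 := abs_sub_abs_le_abs_sub (c * x i ^ (N + 2)) (-(MvPolynomial.eval x (p i)))
  rw [sub_neg_eq_add, abs_neg, h3] at h4
  rw [Real.norm_eq_abs]
  have h5 : ‖x‖ ≤ ‖x‖ ^ (N + 1) := le_self_pow₀ hr1 (by omega)
  have h6 : ‖x‖ ^ (N + 1) * 11 ≤ ‖x‖ ^ (N + 1) * (c * ‖x‖ - C i) :=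
    mul_le_mul_of_nonneg_left (by linarith) (by positivity)
  rw [add_comm (c * _)] at h4
  nlinarith

lemma approx {m : ℕ} (hm : 1 ≤ m) (F : C(Fin m → ℝ, Fin m → ℝ)) (R ε : ℝ) (hR : 1 ≤ R)
    (hε : 0 < ε) : ∃ G : C(Fin m → ℝ, Fin m → ℝ),
      (¬ ∃ (g : C(Fin m → ℝ, Fin m → ℝ)) (n : ℕ), 2 ≤ n ∧ ⇑G = (⇑g)^[n]) ∧
      ∀ x, ‖x‖ ≤ R → dist (F x) (G x) < ε := by
  choose p hp using fun i => weier R (fun x => F x i) (by fun_prop) (ε / 2) (by positivity)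
  set N := ∑ i, (p i).totalDegree with hNdef
  have hN : ∀ i, (p i).totalDegree ≤ N := fun i =>
    Finset.single_le_sum (f := fun i => (p i).totalDegree) (fun _ _ => Nat.zero_le _)
      (Finset.mem_univ i)
  set c := ε / 4 / R ^ (N + 2) with hcdef
  have hc : 0 < c := by positivity
  obtain ⟨T, hT1, hT⟩ := growth p c hc N (fun i => (hN i).trans (Nat.le_succ _)) hm
  have hfib := finite_fiber p c hc.ne' (N + 2) (fun i => by have := hN i; omega)
  set P : (Fin m → ℝ) → (Fin m → ℝ) :=
    fun x i => MvPolynomial.eval x (p i) + c * x i ^ (N + 2) with hP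
  have hPc : Continuous P := by
    refine continuous_pi fun i => ?_
    exact ((p i).continuous_eval).add (by fun_prop)
  have hPF : ∀ x, ‖x‖ ≤ R → dist (F x) (P x) < ε := by
    intro x hx
    rw [dist_pi_lt_iff hε]
    intro i
    rw [dist_comm, Real.dist_eq]
    have h1 := hp i x hx
    have h2 : |c * x i ^ (N + 2)| ≤ ε / 4 := by
      rw [abs_mul, abs_pow, abs_of_pos hc]
      calc c * |x i| ^ (N + 2) ≤ c * R ^ (N + 2) := by
            gcongr
            exact (norm_le_pi_norm x i).trans hx
        _ = ε / 4 := by rw [hcdef]; field_simp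
    simp only [hP]
    rw [abs_lt] at h1 ⊢
    rw [abs_le] at h2
    constructor <;> linarith [h1.1, h1.2, h2.1, h2.2]
  have : Nonempty (Fin m) := ⟨⟨0, hm⟩⟩
  set b : Fin m → ℝ := fun _ => T + R with hb
  have hbn : ‖b‖ = T + R := by
    rw [hb, pi_norm_const, Real.norm_of_nonneg (by linarith)]
  set c0 := P b with hc0
  have hc0n : ‖b‖ + 10 ≤ ‖c0‖ := hT b (by linarith)
  set x0 := P c0 with hx0
  have hx0n : ‖c0‖ + 10 ≤ ‖x0‖ := hT c0 (by linarith)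
  have far : ∀ z : Fin m → ℝ, (‖z‖ + 2 ≤ ‖c0‖ ∨ ‖c0‖ + 2 ≤ ‖z‖) → collapse c0 z = z := by
    intro z hz
    apply collapse_far
    have h1 := norm_sub_norm_le z c0
    have h2 := norm_sub_norm_le c0 z
    rw [norm_sub_rev] at h2
    rcases hz with h | h <;> linarith
  let G : C(Fin m → ℝ, Fin m → ℝ) := ⟨fun x => P (collapse c0 x), hPc.comp (collapse_cont c0)⟩
  have hG : ∀ x, G x = P (collapse c0 x) := fun _ => rfl
  have hGb : G b = c0 := by rw [hG, far b (Or.inl (by linarith))]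
  have hGc : G c0 = x0 := by rw [hG, collapse_near _ _ (by simp)]
  refine ⟨G, ?_, ?_⟩
  · rintro ⟨g, n, hn, hGg⟩
    refine no_root G g n hn hGg x0 ?_ ?_ ?_
    · intro y hy
      have hf : (P ⁻¹' {y}).Finite := by
        refine (hfib y).subset ?_
        intro x hx i
        exact congrFun hx i
      refine (Set.Finite.preimage (f := collapse c0) ?_ hf).countable
      intro x hx z _ hxz
      refine collapse_inj c0 x z hxz ?_
      intro h
      apply hy
      have : P (collapse c0 x) = y := hx
      rw [← this, h]
    · have hk : ∀ k : ℕ, ‖x0‖ + 10 * k ≤ ‖(⇑G)^[k] x0‖ := by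
        intro k
        induction k with
        | zero => simp
        | succ k ih =>
          rw [Function.iterate_succ_apply']
          set z := (⇑G)^[k] x0
          have hk0 : (0:ℝ) ≤ k := Nat.cast_nonneg k
          have hz := hT z (by linarith)
          rw [hG, far z (Or.inr (by linarith))]
          push_cast
          change ‖z‖ + 10 ≤ ‖P z‖ at hz
          linarith
      intro k hk1 h
      have h1 := hk k
      rw [h] at h1
      have : (1:ℝ) ≤ k := by exact_mod_cast hk1
      linarith
    · intro hcount
      have h1 := hcount.image (fun z => ‖z - c0‖)
      have h2 : Set.Icc (0:ℝ) 1 ⊆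
          (fun z => ‖z - c0‖) '' (⇑G ⁻¹' {x0} ∩ Set.range ⇑G) := by
        intro t ht
        have hcont : Continuous fun x => ‖G x - c0‖ := by fun_prop
        have h3 := mem_range_of_exists_le_of_exists_ge hcont (c := t)
          ⟨b, by rw [hGb]; simpa using ht.1⟩
          ⟨c0, by
            rw [hGc]
            have := norm_sub_norm_le x0 c0
            linarith [ht.2]⟩
        obtain ⟨x, hx⟩ := h3
        simp only at hx
        refine ⟨G x, ⟨?_, x, rfl⟩, hx⟩
        simp only [Set.mem_preimage, Set.mem_singleton_iff]
        rw [hG (G x), collapse_near _ _ (by rw [hx]; exact ht.2)]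
      have h4 := (h1.mono h2).measure_zero MeasureTheory.volume
      simp at h4
  · intro x hx
    rw [hG, far x (Or.inl (by linarith))]
    exact hPF x hx

/-- **Density of non-iterates for `ℝ^m`.** The complement in `C(ℝ^m)` of
`W(ℝ^m) = {fⁿ : f ∈ C(ℝ^m), n ≥ 2}` is dense in `C(ℝ^m)` (compact-open
topology). -/
theorem dense_non_iterates_euclidean (m : ℕ) (hm : 1 ≤ m) :
    Dense ({F : C(Fin m → ℝ, Fin m → ℝ) |
        ∃ (g : C(Fin m → ℝ, Fin m → ℝ)) (n : ℕ),
          2 ≤ n ∧ ⇑F = (⇑g)^[n]}ᶜ) := by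
  intro F
  choose G hG1 hG2 using fun k : ℕ => approx hm F (k + 1) (1 / (k + 1))
    (by have : (0:ℝ) ≤ k := Nat.cast_nonneg k
        linarith) (by positivity)
  refine mem_closure_of_tendsto (f := G) (b := Filter.atTop) ?_ (Filter.Eventually.of_forall hG1)
  rw [ContinuousMap.tendsto_iff_forall_isCompact_tendstoUniformlyOn]
  intro K hK
  rw [Metric.tendstoUniformlyOn_iff]
  intro ε hε
  obtain ⟨R, hR⟩ := hK.isBounded.exists_norm_le
  obtain ⟨k1, hk1⟩ := exists_nat_ge R
  obtain ⟨k2, hk2⟩ := exists_nat_one_div_lt hε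
  filter_upwards [Filter.eventually_ge_atTop (max k1 k2)] with k hk x hx
  have e1 : (k1:ℝ) ≤ k := by exact_mod_cast (le_max_left _ _).trans hk
  have e2 : (k2:ℝ) ≤ k := by exact_mod_cast (le_max_right _ _).trans hk
  refine (hG2 k x (by linarith [hR x hx])).trans (lt_of_le_of_lt ?_ hk2)
  gcongr
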